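/- Let R_1, R_2 be reduced words for the longest element w_0 ∈ S_n that are not commutation-equivalent. Then there exists x ∈ S_n with wt_{R_1}(x) ≠ wt_{R_2}(x) in ℤ[q]; equivalently, the Bott–Samelson distributions 𝔓_{R_1,q} and 𝔓_{R_2,q} are different as rational functions of q. -/

import Mathlib

open scoped Classical

namespace BSDist

/-- The simple transposition `s i` (1-indexed): it swaps the values `i` and `i+1`
of `{1,…,n}`, i.e. the elements `i-1` and `i` of `Fin n`.  Out-of-range letters
give the identity. -/
def sTr (n : ℕ) (i : ℕ) : Equiv.Perm (Fin n) :=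
  if h : 1 ≤ i ∧ i < n then Equiv.swap ⟨i - 1, by omega⟩ ⟨i, h.2⟩ else 1

/-- The product `w(R) = s_{i₁} ⋯ s_{i_L}` of a word. -/
def wprod (n : ℕ) (R : List ℕ) : Equiv.Perm (Fin n) := (R.map (sTr n)).prod

/-- The Coxeter length of a permutation: its number of inversions. -/
def len {n : ℕ} (w : Equiv.Perm (Fin n)) : ℕ :=
  (Finset.univ.filter (fun p : Fin n × Fin n => p.1 < p.2 ∧ w p.2 < w p.1)).card

/-- A word over the alphabet `{1,…,n-1}`. -/
def Alphabet (n : ℕ) (R : List ℕ) : Prop := ∀ i ∈ R, 1 ≤ i ∧ i < n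

/-- `R` is a reduced word (over the alphabet `{1,…,n-1}`). -/
def IsReducedWord (n : ℕ) (R : List ℕ) : Prop :=
  Alphabet n R ∧ R.length = len (wprod n R)

/-- `R` is a reduced word for `w`. -/
def IsReducedWordFor (n : ℕ) (R : List ℕ) (w : Equiv.Perm (Fin n)) : Prop :=
  IsReducedWord n R ∧ wprod n R = w

/-- The weight `wt_R : S_n → ℤ[q]`, defined by the recursion
`wt_∅(e) = 1`, `wt_∅(x) = 0` for `x ≠ e`, and for an appended letter `i`:
`wt_{Ri}(x) = wt_R(x) + wt_R(x sᵢ)` if `ℓ(x sᵢ) > ℓ(x)`, and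
`wt_{Ri}(x) = q·wt_R(x) + q·wt_R(x sᵢ)` if `ℓ(x sᵢ) < ℓ(x)`. -/
noncomputable def wt (n : ℕ) (R : List ℕ) : Equiv.Perm (Fin n) → Polynomial ℤ :=
  R.foldl
    (fun f i x =>
      if len x < len (x * sTr n i) then f x + f (x * sTr n i)
      else Polynomial.X * f x + Polynomial.X * f (x * sTr n i))
    (fun x => if x = 1 then 1 else 0)

/-- A single commutation move: replace a consecutive factor `ij` by `ji` where
`|i - j| > 1`. -/
def CommMove (R R' : List ℕ) : Prop :=
  ∃ (A B : List ℕ) (i j : ℕ), (i + 1 < j ∨ j + 1 < i) ∧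
    R = A ++ [i, j] ++ B ∧ R' = A ++ [j, i] ++ B

/-- Commutation equivalence: a finite sequence of commutation moves. -/
def CommEquiv (R R' : List ℕ) : Prop := Relation.ReflTransGen CommMove R R'

/-- A single braid move: replace a consecutive factor `k(k+1)k` by `(k+1)k(k+1)`. -/
def BraidMove (R R' : List ℕ) : Prop :=
  ∃ (A B : List ℕ) (k : ℕ),
    R = A ++ [k, k + 1, k] ++ B ∧ R' = A ++ [k + 1, k, k + 1] ++ B

/-- The Demazure product of a word, computed left to right:
`w ∗ sᵢ = w sᵢ` if `ℓ(w sᵢ) > ℓ(w)`, and `w ∗ sᵢ = w` otherwise. -/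
def dem (n : ℕ) (R : List ℕ) : Equiv.Perm (Fin n) :=
  R.foldl (fun w i => if len w < len (w * sTr n i) then w * sTr n i else w) 1

/-- `app w t` is the value `w(t)` in 1-indexed one-line notation:
positions and values both run through `{1,…,n}`. -/
def app {n : ℕ} (w : Equiv.Perm (Fin n)) (t : ℕ) : ℕ :=
  if h : 1 ≤ t ∧ t ≤ n then ((w ⟨t - 1, by omega⟩ : Fin n) : ℕ) + 1 else 0

/-- `posOf x t = x⁻¹(t)`, the (1-indexed) position of the value `t` in `x`. -/
def posOf {n : ℕ} (x : Equiv.Perm (Fin n)) (t : ℕ) : ℕ := app x⁻¹ t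

/-- The longest element `w₀` of `S_n` (the order-reversing permutation). -/
def w0 (n : ℕ) : Equiv.Perm (Fin n) := ⟨Fin.rev, Fin.rev, Fin.rev_rev, Fin.rev_rev⟩

/-- The value pair `(a,b)` (with `a < b`) is an inversion of `x`:
`x⁻¹(a) > x⁻¹(b)`. -/
def IsInversion {n : ℕ} (x : Equiv.Perm (Fin n)) (a b : ℕ) : Prop :=
  posOf x b < posOf x a

/-- `tau R a b` is the first time `k` at which the pair `(a,b)` is an inversion
of the prefix product `s_{i₁} ⋯ s_{i_k}`. -/
noncomputable def tau (n : ℕ) (R : List ℕ) (a b : ℕ) : ℕ :=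
  sInf {k | IsInversion (wprod n (R.take k)) a b}

/-- `T_R(a,b,c) = +1` if `τ_R(a,b) < τ_R(b,c)` and `-1` otherwise. -/
noncomputable def T (n : ℕ) (R : List ℕ) (a b c : ℕ) : ℤ :=
  if tau n R a b < tau n R b c then 1 else -1

/-- `Supp(x) = {t : pos_x(t) ≠ pos_{w₀}(t)}`. -/
noncomputable def Supp (n : ℕ) (x : Equiv.Perm (Fin n)) : Finset ℕ :=
  (Finset.Icc 1 n).filter (fun t => posOf x t ≠ posOf (w0 n) t)

/-- `Fwd(x) = {t : pos_x(t) < pos_{w₀}(t)}`. -/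
noncomputable def Fwd (n : ℕ) (x : Equiv.Perm (Fin n)) : Finset ℕ :=
  (Finset.Icc 1 n).filter (fun t => posOf x t < posOf (w0 n) t)

/-- `Bwd(x) = {t : pos_x(t) > pos_{w₀}(t)}`. -/
noncomputable def Bwd (n : ℕ) (x : Equiv.Perm (Fin n)) : Finset ℕ :=
  (Finset.Icc 1 n).filter (fun t => posOf (w0 n) t < posOf x t)

/-- `D_R(x)`: the coefficient of `q^{N-1}` in `wt_R(x)`, where `N = n(n-1)/2`. -/
noncomputable def D (n : ℕ) (R : List ℕ) (x : Equiv.Perm (Fin n)) : ℤ :=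
  (wt n R x).coeff (n * (n - 1) / 2 - 1)

/-- `σ_b(x) = sign(pos_x(b) − pos_{w₀}(b)) ∈ {−1,0,+1}`. -/
noncomputable def sigmaVal (n : ℕ) (b : ℕ) (x : Equiv.Perm (Fin n)) : ℤ :=
  Int.sign ((posOf x b : ℤ) - (posOf (w0 n) b : ℤ))

/-- `Θ_R(a,b,c) = Σ_{x : Supp(x) = [a,c]} D_R(x)·σ_b(x)`. -/
noncomputable def Theta (n : ℕ) (R : List ℕ) (a b c : ℕ) : ℤ :=
  ∑ x ∈ Finset.univ.filter (fun x : Equiv.Perm (Fin n) => Supp n x = Finset.Icc a c),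
    D n R x * sigmaVal n b x

end BSDist

namespace BSDist

def pos {n : ℕ} (g : Equiv.Perm (Fin n)) (v : Fin n) : ℕ := ((g⁻¹ v : Fin n) : ℕ)

lemma pos_inj {n : ℕ} (g : Equiv.Perm (Fin n)) {v w : Fin n} (h : pos g v = pos g w) : v = w :=
  g⁻¹.injective (Fin.ext h)

lemma pos_surj {n : ℕ} (g : Equiv.Perm (Fin n)) {k : ℕ} (h : k < n) : ∃ v, pos g v = k :=
  ⟨g ⟨k, h⟩, by simp [pos]⟩

lemma pos_mul {n : ℕ} (g : Equiv.Perm (Fin n)) {i : ℕ} (h1 : 1 ≤ i) (h2 : i < n) (v : Fin n) :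
    pos (g * sTr n i) v =
      if pos g v + 1 = i then i else if pos g v = i then i - 1 else pos g v := by
  unfold pos sTr
  rw [dif_pos ⟨h1, h2⟩, mul_inv_rev, Equiv.Perm.mul_apply, Equiv.swap_inv, Equiv.swap_apply_def]
  simp only [Fin.ext_iff]
  split_ifs <;> simp_all <;> omega

lemma pos_w0 {n : ℕ} (v : Fin n) : pos (w0 n) v + v + 1 = n := by
  have : (w0 n)⁻¹ v = Fin.rev v := by
    rw [Equiv.Perm.inv_eq_iff_eq]; simp [w0]
  unfold pos
  rw [this, Fin.val_rev]; omega

lemma pos_one {n : ℕ} (v : Fin n) : pos (1 : Equiv.Perm (Fin n)) v = v := by simp [pos]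

def Asc {n : ℕ} (g : Equiv.Perm (Fin n)) (i : ℕ) : Prop :=
  ∀ v w : Fin n, pos g v + 1 = i → pos g w = i → v < w

lemma sTr_mul_self (n i : ℕ) : sTr n i * sTr n i = 1 := by
  unfold sTr; split_ifs <;> simp

lemma sTr_cancel {n i : ℕ} (x : Equiv.Perm (Fin n)) : x * sTr n i * sTr n i = x := by
  rw [mul_assoc, sTr_mul_self, mul_one]

lemma len_eq {n : ℕ} (w : Equiv.Perm (Fin n)) :
    len w = (Finset.univ.filter
      (fun p : Fin n × Fin n => p.1 < p.2 ∧ pos w p.2 < pos w p.1)).card := by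
  unfold len
  refine Finset.card_bij (fun p _ => (w p.2, w p.1)) ?_ ?_ ?_
  · intro p hp; simp [pos] at hp ⊢; exact ⟨hp.2, hp.1⟩
  · intro p _ q _ h; simp at h; exact Prod.ext h.2 h.1
  · intro p hp
    refine ⟨(w⁻¹ p.2, w⁻¹ p.1), ?_, by simp⟩
    simp [pos] at hp ⊢; exact ⟨hp.2, hp.1⟩

lemma len_asc {n : ℕ} (x : Equiv.Perm (Fin n)) {i : ℕ} (h1 : 1 ≤ i) (h2 : i < n)
    (h : Asc x i) : len (x * sTr n i) = len x + 1 := by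
  obtain ⟨l, hl⟩ := pos_surj x (show i - 1 < n by omega)
  obtain ⟨r, hr⟩ := pos_surj x h2
  have hlr := h l r (by omega) hr
  rw [len_eq, len_eq]
  rw [← Finset.card_insert_of_notMem (a := (l, r))]
  · congr 1
    ext ⟨v, w⟩
    simp only [Finset.mem_filter, Finset.mem_univ, true_and, Finset.mem_insert, Prod.mk.injEq,
      pos_mul x h1 h2]
    have e1 : pos x v + 1 = i ↔ v = l :=
      ⟨fun e => pos_inj x (by omega), fun e => by subst e; omega⟩
    have e2 : pos x w + 1 = i ↔ w = l :=
      ⟨fun e => pos_inj x (by omega), fun e => by subst e; omega⟩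
    have e3 : pos x v = i ↔ v = r :=
      ⟨fun e => pos_inj x (by omega), fun e => by subst e; omega⟩
    have e4 : pos x w = i ↔ w = r :=
      ⟨fun e => pos_inj x (by omega), fun e => by subst e; omega⟩
    constructor
    · rintro ⟨hvw, hp⟩
      by_cases hh : v = l ∧ w = r
      · exact Or.inl hh
      · right
        refine ⟨hvw, ?_⟩
        have : ¬ (v = r ∧ w = l) := by rintro ⟨rfl, rfl⟩; exact absurd hvw (not_lt.2 hlr.le)
        have hne : pos x v ≠ pos x w := fun e => hvw.ne (pos_inj x e)
        rw [← e1, ← e4] at hh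
        rw [← e3, ← e2] at this
        split_ifs at hp <;> omega
    · rintro (⟨rfl, rfl⟩ | ⟨hvw, hp⟩)
      · refine ⟨hlr, ?_⟩
        split_ifs <;> omega
      · refine ⟨hvw, ?_⟩
        have : ¬ (v = l ∧ w = r) := by rintro ⟨rfl, rfl⟩; omega
        have : ¬ (v = r ∧ w = l) := by rintro ⟨rfl, rfl⟩; exact absurd hvw (not_lt.2 hlr.le)
        rw [← e3, ← e2] at this
        split_ifs <;> omega
  · simp; intro _; omega

lemma asc_or {n : ℕ} (x : Equiv.Perm (Fin n)) {i : ℕ} (h1 : 1 ≤ i) (h2 : i < n) :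
    Asc x i ∨ Asc (x * sTr n i) i := by
  by_cases h : Asc x i
  · exact Or.inl h
  · right
    unfold Asc at h ⊢
    push Not at h
    obtain ⟨v, w, hv, hw, hvw⟩ := h
    intro v' w' hv' hw'
    rw [pos_mul x h1 h2] at hv' hw'
    have e1 : v' = w := pos_inj x (by split_ifs at hv' <;> omega)
    have e2 : w' = v := pos_inj x (by split_ifs at hw' <;> omega)
    subst e1 e2
    refine lt_of_le_of_ne hvw ?_
    rintro rfl; omega

lemma len_lt_iff {n : ℕ} (x : Equiv.Perm (Fin n)) {i : ℕ} (h1 : 1 ≤ i) (h2 : i < n) :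
    len x < len (x * sTr n i) ↔ Asc x i := by
  constructor
  · intro h
    rcases asc_or x h1 h2 with h' | h'
    · exact h'
    · have := len_asc _ h1 h2 h'
      rw [sTr_cancel] at this; omega
  · intro h; rw [len_asc x h1 h2 h]; omega

lemma not_asc_mul {n : ℕ} (x : Equiv.Perm (Fin n)) {i : ℕ} (h1 : 1 ≤ i) (h2 : i < n)
    (h : Asc x i) : ¬ Asc (x * sTr n i) i := by
  rw [← len_lt_iff _ h1 h2, sTr_cancel, len_asc x h1 h2 h]; omega

lemma asc_mul_iff {n : ℕ} (x : Equiv.Perm (Fin n)) {i : ℕ} (h1 : 1 ≤ i) (h2 : i < n) :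
    Asc (x * sTr n i) i ↔ ¬ Asc x i :=
  ⟨fun h h' => not_asc_mul x h1 h2 h' h, fun h => (asc_or x h1 h2).resolve_left h⟩

/-- every step of the word is an ascent -/
def AscP {n : ℕ} : Equiv.Perm (Fin n) → List ℕ → Prop
  | _, [] => True
  | g, i :: S => (1 ≤ i ∧ i < n) ∧ Asc g i ∧ AscP (g * sTr n i) S

lemma wprod_cons (n i : ℕ) (S : List ℕ) : wprod n (i :: S) = sTr n i * wprod n S := by
  simp [wprod]

lemma wprod_nil (n : ℕ) : wprod n [] = 1 := rfl

lemma wprod_append (n : ℕ) (S S' : List ℕ) : wprod n (S ++ S') = wprod n S * wprod n S' := by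
  simp [wprod]

lemma ascP_append {n : ℕ} (g : Equiv.Perm (Fin n)) (A B : List ℕ) :
    AscP g (A ++ B) ↔ AscP g A ∧ AscP (g * wprod n A) B := by
  induction A generalizing g with
  | nil => simp [AscP, wprod_nil]
  | cons i A ih => simp [AscP, wprod_cons, ih, mul_assoc, and_assoc]

lemma len_le {n : ℕ} (S : List ℕ) (hS : Alphabet n S) (g : Equiv.Perm (Fin n)) :
    len (g * wprod n S) ≤ len g + S.length := by
  induction S generalizing g with
  | nil => simp [wprod_nil]
  | cons i S ih =>
    have hi := hS i (by simp)
    have := ih (fun j hj => hS j (by simp [hj])) (g * sTr n i)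
    rw [wprod_cons, ← mul_assoc]
    have h2 : len (g * sTr n i) ≤ len g + 1 := by
      rcases asc_or g hi.1 hi.2 with h | h
      · exact (len_asc g hi.1 hi.2 h).le
      · have := len_asc _ hi.1 hi.2 h
        rw [sTr_cancel] at this; omega
    simp; omega

lemma ascP_of_len {n : ℕ} (S : List ℕ) (hS : Alphabet n S) (g : Equiv.Perm (Fin n))
    (h : len g + S.length ≤ len (g * wprod n S)) : AscP g S := by
  induction S generalizing g with
  | nil => trivial
  | cons i S ih =>
    have hi := hS i (by simp)
    have hS' : Alphabet n S := fun j hj => hS j (by simp [hj])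
    have := len_le S hS' (g * sTr n i)
    rw [wprod_cons, ← mul_assoc] at h
    simp only [List.length_cons] at h
    have ha : Asc g i := by
      rw [← len_lt_iff g hi.1 hi.2]; omega
    refine ⟨hi, ha, ih hS' _ ?_⟩
    rw [len_asc g hi.1 hi.2 ha]; omega

lemma len_one (n : ℕ) : len (1 : Equiv.Perm (Fin n)) = 0 := by
  unfold len
  rw [Finset.card_eq_zero, Finset.filter_eq_empty_iff]
  rintro ⟨a, b⟩ - ⟨h, h'⟩
  exact absurd h (not_lt.2 (le_of_lt h'))

lemma ascP_of_reduced {n : ℕ} {R : List ℕ} (h : IsReducedWord n R) : AscP (1 : Equiv.Perm (Fin n)) R := by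
  apply ascP_of_len R h.1
  rw [len_one, one_mul, h.2]; omega

lemma pos_step {n : ℕ} {g : Equiv.Perm (Fin n)} {i : ℕ} (hi : 1 ≤ i ∧ i < n) (h : Asc g i)
    {v w : Fin n} (hvw : v < w) (hp : pos g w < pos g v) :
    pos (g * sTr n i) w < pos (g * sTr n i) v := by
  rw [pos_mul g hi.1 hi.2, pos_mul g hi.1 hi.2]
  have := h w v
  have h3 : ¬ (pos g w + 1 = i ∧ pos g v = i) := fun e => absurd (this e.1 e.2) (not_lt.2 hvw.le)
  split_ifs <;> omega

/-- if `v, w` are not the crossing pair then their relative order is preserved -/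
lemma pos_step' {n : ℕ} {g : Equiv.Perm (Fin n)} {i : ℕ} (hi : 1 ≤ i ∧ i < n)
    {v w : Fin n} (hp : pos g w < pos g v) (hc : ¬ (pos g w + 1 = i ∧ pos g v = i)) :
    pos (g * sTr n i) w < pos (g * sTr n i) v := by
  rw [pos_mul g hi.1 hi.2, pos_mul g hi.1 hi.2]
  split_ifs <;> omega

lemma pos_run {n : ℕ} {g : Equiv.Perm (Fin n)} {S : List ℕ} (h : AscP g S)
    {v w : Fin n} (hvw : v < w) (hp : pos g w < pos g v) :
    pos (g * wprod n S) w < pos (g * wprod n S) v := by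
  induction S generalizing g with
  | nil => simpa [wprod_nil] using hp
  | cons i S ih =>
    rw [wprod_cons, ← mul_assoc]
    exact ih h.2.2 (pos_step h.1 h.2.1 hvw hp)

end BSDist

namespace BSDist

def Good {n : ℕ} (T : Fin n → Fin n → Fin n → Prop) : Equiv.Perm (Fin n) → List ℕ → Prop
  | g, [] => g = w0 n
  | g, i :: S => (1 ≤ i ∧ i < n) ∧ (∀ a c, pos g a + 1 = i → pos g c = i →
      a < c ∧ ∀ b, a < b → b < c → (T a b c ↔ pos g b < pos g a)) ∧ Good T (g * sTr n i) S

lemma Good.asc {n : ℕ} {T : Fin n → Fin n → Fin n → Prop} {g : Equiv.Perm (Fin n)} {i : ℕ}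
    {S : List ℕ} (h : Good T g (i :: S)) : Asc g i := fun v w hv hw => (h.2.1 v w hv hw).1

lemma good_neg {n : ℕ} {T : Fin n → Fin n → Fin n → Prop} {S : List ℕ} {g : Equiv.Perm (Fin n)}
    (h : Good T g S) {x y z : Fin n} (hxy : x < y) (hyz : y < z) (h1 : pos g z < pos g y)
    (h2 : pos g x < pos g z) : ¬ T x y z := by
  induction S generalizing g with
  | nil =>
    have h : g = w0 n := h
    subst h
    have := pos_w0 x; have := pos_w0 z
    have : (x : ℕ) < z := hxy.trans hyz
    omega
  | cons i S ih =>
    by_cases hc : pos g x + 1 = i ∧ pos g z = i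
    · rw [(h.2.1 x z hc.1 hc.2).2 y hxy hyz]; omega
    · exact ih h.2.2 (pos_step h.1 h.asc hyz h1) (pos_step' h.1 h2 hc)

lemma good_pos {n : ℕ} {T : Fin n → Fin n → Fin n → Prop} {S : List ℕ} {g : Equiv.Perm (Fin n)}
    (h : Good T g S) {x y z : Fin n} (hxy : x < y) (hyz : y < z) (h1 : pos g y < pos g x)
    (h2 : pos g x < pos g z) : T x y z := by
  induction S generalizing g with
  | nil =>
    have h : g = w0 n := h
    subst h
    have := pos_w0 x; have := pos_w0 z
    have : (x : ℕ) < z := hxy.trans hyz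
    omega
  | cons i S ih =>
    by_cases hc : pos g x + 1 = i ∧ pos g z = i
    · rw [(h.2.1 x z hc.1 hc.2).2 y hxy hyz]; omega
    · exact ih h.2.2 (pos_step h.1 h.asc hxy h1) (pos_step' h.1 h2 hc)

lemma sTr_comm {n i j : ℕ} (hi : 1 ≤ i ∧ i < n) (hj : 1 ≤ j ∧ j < n)
    (h : i + 1 < j ∨ j + 1 < i) (g : Equiv.Perm (Fin n)) :
    g * sTr n i * sTr n j = g * sTr n j * sTr n i := by
  apply inv_injective
  ext v
  change pos _ v = pos _ v
  rw [pos_mul _ hj.1 hj.2, pos_mul _ hi.1 hi.2, pos_mul _ hi.1 hi.2, pos_mul _ hj.1 hj.2]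
  split_ifs <;> omega

lemma good_swap {n : ℕ} {T : Fin n → Fin n → Fin n → Prop} {S : List ℕ} {g : Equiv.Perm (Fin n)}
    {i j : ℕ} (h : Good T g (i :: j :: S)) (hf : i + 1 < j ∨ j + 1 < i) :
    Good T g (j :: i :: S) := by
  obtain ⟨hi, h1, hj, h2, h3⟩ := h
  refine ⟨hj, ?_, hi, ?_, ?_⟩
  · intro a c ha hc
    obtain ⟨h4, h5⟩ := h2 a c (by rw [pos_mul _ hi.1 hi.2]; split_ifs <;> omega)
      (by rw [pos_mul _ hi.1 hi.2]; split_ifs <;> omega)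
    refine ⟨h4, fun b hb hb' => ?_⟩
    rw [h5 b hb hb', pos_mul _ hi.1 hi.2, pos_mul _ hi.1 hi.2]
    split_ifs <;> omega
  · intro a c ha hc
    rw [pos_mul _ hj.1 hj.2] at ha hc
    obtain ⟨h4, h5⟩ := h1 a c (by split_ifs at ha <;> omega) (by split_ifs at hc <;> omega)
    refine ⟨h4, fun b hb hb' => ?_⟩
    rw [h5 b hb hb', pos_mul _ hj.1 hj.2, pos_mul _ hj.1 hj.2]
    split_ifs at ha ⊢ <;> omega
  · rw [sTr_comm hj hi (by tauto)]; exact h3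

lemma commMove_cons {R R' : List ℕ} (k : ℕ) (h : CommMove R R') : CommMove (k :: R) (k :: R') := by
  obtain ⟨A, B, i, j, hf, rfl, rfl⟩ := h
  exact ⟨k :: A, B, i, j, hf, by simp, by simp⟩

lemma commEquiv_cons {R R' : List ℕ} (k : ℕ) (h : CommEquiv R R') :
    CommEquiv (k :: R) (k :: R') := by
  induction h with
  | refl => exact Relation.ReflTransGen.refl
  | tail _ h ih => exact Relation.ReflTransGen.tail ih (commMove_cons k h)

lemma commMove_symm {R R' : List ℕ} (h : CommMove R R') : CommMove R' R := by
  obtain ⟨A, B, i, j, hf, rfl, rfl⟩ := h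
  exact ⟨A, B, j, i, hf.symm, rfl, rfl⟩

lemma commEquiv_symm {R R' : List ℕ} (h : CommEquiv R R') : CommEquiv R' R := by
  induction h with
  | refl => exact Relation.ReflTransGen.refl
  | tail _ h ih => exact Relation.ReflTransGen.head (commMove_symm h) ih

lemma good_pull {n : ℕ} {T : Fin n → Fin n → Fin n → Prop} {S : List ℕ} {g : Equiv.Perm (Fin n)}
    (h : Good T g S) {i : ℕ} {a c : Fin n} (ha : pos g a + 1 = i) (hc : pos g c = i) (hac : a < c)
    (h1 : ∀ b, b < a → pos g b < pos g a → ¬ T b a c)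
    (h2 : ∀ b, c < b → pos g c < pos g b → T a c b) :
    ∃ S', CommEquiv S (i :: S') ∧ Good T g (i :: S') := by
  induction S generalizing g with
  | nil =>
    have h : g = w0 n := h
    subst h
    have := pos_w0 a; have := pos_w0 c
    have : (a : ℕ) < c := hac
    omega
  | cons k S ih =>
    by_cases hk : k = i
    · subst hk; exact ⟨S, Relation.ReflTransGen.refl, h⟩
    obtain ⟨hk1, hk2, hS⟩ := id h
    have hf : k + 1 < i ∨ i + 1 < k := by
      by_contra hcon
      have : k + 1 = i ∨ k = i + 1 := by omega
      rcases this with e | e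
      · obtain ⟨b, hb⟩ := pos_surj g (show k - 1 < n by omega)
        have hba := (hk2 b a (by omega) (by omega)).1
        refine h1 b hba (by omega) (good_pos hS hba hac ?_ ?_)
        · rw [pos_mul _ hk1.1 hk1.2, pos_mul _ hk1.1 hk1.2]; split_ifs <;> omega
        · rw [pos_mul _ hk1.1 hk1.2, pos_mul _ hk1.1 hk1.2]; split_ifs <;> omega
      · obtain ⟨b, hb⟩ := pos_surj g hk1.2
        have hcb := (hk2 c b (by omega) (by omega)).1
        refine good_neg hS hac hcb ?_ ?_ (h2 b hcb (by omega))
        · rw [pos_mul _ hk1.1 hk1.2, pos_mul _ hk1.1 hk1.2]; split_ifs <;> omega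
        · rw [pos_mul _ hk1.1 hk1.2, pos_mul _ hk1.1 hk1.2]; split_ifs <;> omega
    have ea : pos (g * sTr n k) a = pos g a := by
      rw [pos_mul _ hk1.1 hk1.2]; split_ifs <;> omega
    have ec : pos (g * sTr n k) c = pos g c := by
      rw [pos_mul _ hk1.1 hk1.2]; split_ifs <;> omega
    obtain ⟨S', e1, e2⟩ := ih hS (by omega) (by omega)
      (fun b hb hp => h1 b hb (by
        rw [ea, pos_mul _ hk1.1 hk1.2] at hp; split_ifs at hp <;> omega))
      (fun b hb hp => h2 b hb (by
        rw [ec, pos_mul _ hk1.1 hk1.2] at hp; split_ifs at hp <;> omega))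
    refine ⟨k :: S', ?_, ?_⟩
    · refine (commEquiv_cons k e1).trans (Relation.ReflTransGen.single ?_)
      exact ⟨[], S', k, i, hf, by simp, by simp⟩
    · exact good_swap (i := k) ⟨hk1, hk2, e2⟩ hf

lemma good_comm {n : ℕ} {T : Fin n → Fin n → Fin n → Prop} {S₁ S₂ : List ℕ}
    {g : Equiv.Perm (Fin n)} (h₁ : Good T g S₁) (h₂ : Good T g S₂) : CommEquiv S₁ S₂ := by
  induction S₁ generalizing g S₂ with
  | nil =>
    have h : g = w0 n := h₁
    subst h
    cases S₂ with
    | nil => exact Relation.ReflTransGen.refl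
    | cons k S =>
      obtain ⟨hk, h, -⟩ := h₂
      obtain ⟨l, hl⟩ := pos_surj (w0 n) (show k - 1 < n by omega)
      obtain ⟨r, hr⟩ := pos_surj (w0 n) hk.2
      have : (l : ℕ) < r := (h l r (by omega) hr).1
      have := pos_w0 l; have := pos_w0 r
      omega
  | cons i S ih =>
    obtain ⟨hi, h, hS⟩ := id h₁
    obtain ⟨a, ha⟩ := pos_surj g (show i - 1 < n by omega)
    obtain ⟨c, hc⟩ := pos_surj g hi.2
    have hac := (h a c (by omega) hc).1
    obtain ⟨S', e1, e2⟩ := good_pull h₂ (i := i) (a := a) (c := c) (by omega) hc hac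
      (fun b hb hp => good_neg hS hb hac
        (by rw [pos_mul _ hi.1 hi.2, pos_mul _ hi.1 hi.2]; split_ifs <;> omega)
        (by rw [pos_mul _ hi.1 hi.2, pos_mul _ hi.1 hi.2]; split_ifs <;> omega))
      (fun b hb hp => good_pos hS hac hb
        (by rw [pos_mul _ hi.1 hi.2, pos_mul _ hi.1 hi.2]; split_ifs <;> omega)
        (by rw [pos_mul _ hi.1 hi.2, pos_mul _ hi.1 hi.2]; split_ifs <;> omega))
    exact (commEquiv_cons i (ih hS e2.2.2)).trans (commEquiv_symm e1)

end BSDist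

namespace BSDist

/-- one step of the Demazure product -/
noncomputable def dstep (n : ℕ) (w : Equiv.Perm (Fin n)) (i : ℕ) : Equiv.Perm (Fin n) :=
  if len w < len (w * sTr n i) then w * sTr n i else w

lemma dem_eq (n : ℕ) (R : List ℕ) : dem n R = R.foldl (dstep n) 1 := rfl

lemma foldl_dstep_asc {n : ℕ} (g : Equiv.Perm (Fin n)) {S : List ℕ} (h : AscP g S) :
    S.foldl (dstep n) g = g * wprod n S := by
  induction S generalizing g with
  | nil => simp [wprod_nil]
  | cons i S ih =>
    rw [List.foldl_cons, wprod_cons, ← mul_assoc, ← ih _ h.2.2, dstep,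
      if_pos ((len_lt_iff g h.1.1 h.1.2).2 h.2.1)]

section inv
variable {n : ℕ}

def Wp (a c : Fin n) (Bp : Fin n → Prop) (v : Fin n) : Prop :=
  v = a ∨ v = c ∨ (a < v ∧ v < c ∧ Bp v)

def Wm (a c : Fin n) (Bp : Fin n → Prop) (v : Fin n) : Prop :=
  v = a ∨ v = c ∨ (a < v ∧ v < c ∧ ¬ Bp v)

def NextP (W : Fin n → Prop) (p : Equiv.Perm (Fin n)) (v w : Fin n) : Prop :=
  W v ∧ W w ∧ pos p v < pos p w ∧ w < v ∧ ∀ z, W z → pos p v < pos p z → z ≤ w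

def NextM (W : Fin n → Prop) (p : Equiv.Perm (Fin n)) (v w : Fin n) : Prop :=
  W v ∧ W w ∧ pos p w < pos p v ∧ v < w ∧ ∀ z, W z → pos p z < pos p v → w ≤ z

def Lab (a c : Fin n) (Bp : Fin n → Prop) (p : Equiv.Perm (Fin n)) (v w : Fin n) : Prop :=
  NextP (Wp a c Bp) p v w ∨ NextM (Wm a c Bp) p v w ∨
    (w = v ∧ (∀ z, ¬ NextP (Wp a c Bp) p v z) ∧ (∀ z, ¬ NextM (Wm a c Bp) p v z))

structure Inv (a c : Fin n) (Bp : Fin n → Prop) (p x : Equiv.Perm (Fin n)) : Prop where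
  hac : a < c
  pa : ∀ v, Wp a c Bp v → v ≠ a → pos p v < pos p a
  pc : ∀ v, Wm a c Bp v → v ≠ c → pos p c < pos p v
  pef : ∀ e f, a < f → f < e → e < c → Bp e → ¬ Bp f → pos p e < pos p f
  lab : ∀ v w, Lab a c Bp p v w → pos x w = pos p v

lemma exists_lab (a c : Fin n) (Bp : Fin n → Prop) (p : Equiv.Perm (Fin n)) (v : Fin n) :
    ∃ w, Lab a c Bp p v w := by
  by_cases h1 : ∃ w, NextP (Wp a c Bp) p v w
  · exact ⟨_, Or.inl h1.choose_spec⟩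
  by_cases h2 : ∃ w, NextM (Wm a c Bp) p v w
  · exact ⟨_, Or.inr (Or.inl h2.choose_spec)⟩
  push Not at h1 h2
  exact ⟨v, Or.inr (Or.inr ⟨rfl, h1, h2⟩)⟩

/-- For a value not involved in the crossing the label does not change. -/
lemma lab_other {a c : Fin n} {Bp : Fin n → Prop} {p p' : Equiv.Perm (Fin n)} {v : Fin n}
    (h1 : ∀ z, pos p' v < pos p' z ↔ pos p v < pos p z)
    (h2 : ∀ z, pos p' z < pos p' v ↔ pos p z < pos p v) (w : Fin n) :
    Lab a c Bp p' v w ↔ Lab a c Bp p v w := by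
  simp only [Lab, NextP, NextM, h1, h2]


lemma nextP_exists {W : Fin n → Prop} {p : Equiv.Perm (Fin n)} {v : Fin n} (hv : W v)
    (h1 : ∃ z, W z ∧ pos p v < pos p z) (h2 : ∀ z, W z → pos p v < pos p z → z < v) :
    ∃ w, NextP W p v w := by
  obtain ⟨w, hw, hm⟩ := Set.exists_max_image {z | W z ∧ pos p v < pos p z} id
    (Set.toFinite _) h1
  exact ⟨w, hv, hw.1, hw.2, h2 w hw.1 hw.2, fun z hz hz' => hm z ⟨hz, hz'⟩⟩

lemma nextM_exists {W : Fin n → Prop} {p : Equiv.Perm (Fin n)} {v : Fin n} (hv : W v)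
    (h1 : ∃ z, W z ∧ pos p z < pos p v) (h2 : ∀ z, W z → pos p z < pos p v → v < z) :
    ∃ w, NextM W p v w := by
  obtain ⟨w, hw, hm⟩ := Set.exists_min_image {z | W z ∧ pos p z < pos p v} id
    (Set.toFinite _) h1
  exact ⟨w, hv, hw.1, hw.2, h2 w hw.1 hw.2, fun z hz hz' => hm z ⟨hz, hz'⟩⟩

lemma Wp_bd {a c : Fin n} {Bp : Fin n → Prop} (hac : a < c) {v : Fin n} (h : Wp a c Bp v) :
    a ≤ v ∧ v ≤ c := by
  rcases h with rfl | rfl | ⟨h1, h2, _⟩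
  exacts [⟨le_rfl, hac.le⟩, ⟨hac.le, le_rfl⟩, ⟨h1.le, h2.le⟩]

lemma Wm_bd {a c : Fin n} {Bp : Fin n → Prop} (hac : a < c) {v : Fin n} (h : Wm a c Bp v) :
    a ≤ v ∧ v ≤ c := by
  rcases h with rfl | rfl | ⟨h1, h2, _⟩
  exacts [⟨le_rfl, hac.le⟩, ⟨hac.le, le_rfl⟩, ⟨h1.le, h2.le⟩]

lemma WpWm {a c : Fin n} {Bp : Fin n → Prop} {v : Fin n} (h : Wp a c Bp v) (h' : Wm a c Bp v) :
    v = a ∨ v = c := by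
  unfold Wp at h; unfold Wm at h'; tauto

lemma WpOrWm {a c : Fin n} (Bp : Fin n → Prop) {v : Fin n} (h : a ≤ v) (h' : v ≤ c) :
    Wp a c Bp v ∨ Wm a c Bp v := by
  unfold Wp Wm
  rcases h.eq_or_lt with h | h <;> rcases h'.eq_or_lt with h' | h' <;> tauto

lemma noP_of_Wm {a c : Fin n} {Bp : Fin n → Prop} (hac : a < c) {p : Equiv.Perm (Fin n)}
    {v : Fin n} (h : Wm a c Bp v) (hv : v ≠ c) (w : Fin n) : ¬ NextP (Wp a c Bp) p v w := by
  intro hN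
  rcases WpWm hN.1 h with e | e
  · subst e; exact absurd hN.2.2.2.1 (not_lt.2 (Wp_bd hac hN.2.1).1)
  · exact hv e

lemma noM_of_Wp {a c : Fin n} {Bp : Fin n → Prop} (hac : a < c) {p : Equiv.Perm (Fin n)}
    {v : Fin n} (h : Wp a c Bp v) (hv : v ≠ a) (w : Fin n) : ¬ NextM (Wm a c Bp) p v w := by
  intro hN
  rcases WpWm h hN.1 with e | e
  · exact hv e
  · subst e; exact absurd hN.2.2.2.1 (not_lt.2 (Wm_bd hac hN.2.1).2)

lemma lab_unique {a c : Fin n} {Bp : Fin n → Prop} (hac : a < c) {p : Equiv.Perm (Fin n)}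
    {v w w' : Fin n} (h : Lab a c Bp p v w) (h' : Lab a c Bp p v w') : w = w' := by
  have key : ∀ w w', NextP (Wp a c Bp) p v w → NextM (Wm a c Bp) p v w' → False := by
    intro w w' h h'
    rcases WpWm h.1 h'.1 with e | e
    · exact noP_of_Wm hac h'.1 (e.trans_ne hac.ne) w h
    · exact noM_of_Wp hac h.1 (e.trans_ne hac.ne') w' h'
  rcases h with h | h | ⟨e, h1, h2⟩ <;> rcases h' with h' | h' | ⟨e', h1', h2'⟩
  · exact le_antisymm (h'.2.2.2.2 _ h.2.1 h.2.2.1) (h.2.2.2.2 _ h'.2.1 h'.2.2.1)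
  · exact (key _ _ h h').elim
  · exact (h1' _ h).elim
  · exact (key _ _ h' h).elim
  · exact le_antisymm (h.2.2.2.2 _ h'.2.1 h'.2.2.1) (h'.2.2.2.2 _ h.2.1 h.2.2.1)
  · exact (h2' _ h).elim
  · exact (h1 _ h').elim
  · exact (h2 _ h').elim
  · rw [e, e']

lemma lab_step {a c : Fin n} {Bp : Fin n → Prop} {p x p' : Equiv.Perm (Fin n)}
    (hI : Inv a c Bp p x) {l r l0 r0 : Fin n} (hlr : l < r) (hpos : pos p l + 1 = pos p r)
    (f1 : ∀ z, pos p' l < pos p' z ↔ pos p r < pos p z)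
    (f2 : ∀ z, pos p' r < pos p' z ↔ z = l ∨ pos p r < pos p z)
    (f3 : ∀ z, pos p' z < pos p' l ↔ z = r ∨ pos p z < pos p l)
    (f4 : ∀ z, pos p' z < pos p' r ↔ pos p z < pos p l)
    (hl0 : Lab a c Bp p l l0) (hr0 : Lab a c Bp p r r0) :
    (l0 < r0 ∧ Lab a c Bp p' l l0 ∧ Lab a c Bp p' r r0) ∨
    (r0 < l0 ∧ Lab a c Bp p' l r0 ∧ Lab a c Bp p' r l0) := by
  obtain ⟨hac, pa, pc, pef, -⟩ := hI
  have f5 : ∀ z, pos p l < pos p z ↔ z = r ∨ pos p r < pos p z := fun z =>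
    ⟨fun h => by
      by_cases e : pos p z = pos p r
      · exact Or.inl (pos_inj p e)
      · right; omega, by rintro (rfl | h) <;> omega⟩
  have f6 : ∀ z, pos p z < pos p r ↔ z = l ∨ pos p z < pos p l := fun z =>
    ⟨fun h => by
      by_cases e : pos p z = pos p l
      · exact Or.inl (pos_inj p e)
      · right; omega, by rintro (rfl | h) <;> omega⟩
  by_cases hW : Wp a c Bp l ∧ Wp a c Bp r
  · obtain ⟨Wl, Wr⟩ := hW
    have hra : r ≠ a := fun e => absurd (Wp_bd hac Wl).1 (not_le.2 (e ▸ hlr))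
    have par := pa r Wr hra
    have hla : l ≠ a := by rintro rfl; omega
    have nMl := fun p => noM_of_Wp (p := p) hac Wl hla
    have nMr := fun p => noM_of_Wp (p := p) hac Wr hra
    have nPl : ∀ w, ¬ NextP (Wp a c Bp) p l w := fun w h =>
      absurd ((h.2.2.2.2 r Wr (by omega)).trans_lt h.2.2.2.1) (not_lt.2 hlr.le)
    have e0 : l0 = l := by
      rcases hl0 with h | h | h
      · exact (nPl _ h).elim
      · exact (nMl _ _ h).elim
      · exact h.1
    subst e0
    rcases hr0 with h | h | ⟨rfl, h, -⟩
    · have hne : r0 ≠ l0 := by rintro rfl; have := h.2.2.1; omega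
      obtain ⟨-, W0, q1, q2, q3⟩ := h
      rcases lt_or_gt_of_ne hne with hlt | hgt
      · right
        refine ⟨hlt, Or.inl ⟨Wl, W0, (f1 _).2 q1, hlt, fun z hz hz' => q3 z hz ((f1 _).1 hz')⟩,
          Or.inl ⟨Wr, Wl, (f2 _).2 (Or.inl rfl), hlr, fun z hz hz' => ?_⟩⟩
        rcases (f2 _).1 hz' with e | e
        · exact e.le
        · exact (q3 z hz e).trans hlt.le
      · left
        refine ⟨hgt, Or.inr (Or.inr ⟨rfl, fun w hw => ?_, nMl _⟩),
          Or.inl ⟨Wr, W0, (f2 _).2 (Or.inr q1), q2, fun z hz hz' => ?_⟩⟩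
        · exact absurd ((hw.2.2.2.2 r0 W0 ((f1 _).2 q1)).trans_lt hw.2.2.2.1) (not_lt.2 hgt.le)
        · rcases (f2 _).1 hz' with e | e
          · exact e.le.trans hgt.le
          · exact q3 z hz e
    · exact (nMr _ _ h).elim
    · left
      have : ∃ z, Wp a c Bp z ∧ pos p r0 < pos p z ∧ r0 ≤ z := by
        by_contra hcon
        push Not at hcon
        obtain ⟨w, hw⟩ := nextP_exists Wr ⟨a, Or.inl rfl, par⟩ (fun z hz hz' => hcon z hz hz')
        exact h w hw
      obtain ⟨z, Wz, hz, hz'⟩ := this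
      refine ⟨hlr, Or.inr (Or.inr ⟨rfl, fun w hw => ?_, nMl _⟩),
        Or.inr (Or.inr ⟨rfl, fun w hw => ?_, nMr _⟩)⟩
      · exact absurd ((hw.2.2.2.2 z Wz ((f1 _).2 hz)).trans_lt hw.2.2.2.1)
          (not_lt.2 (hlr.le.trans hz'))
      · exact absurd ((hw.2.2.2.2 z Wz ((f2 _).2 (Or.inr hz))).trans_lt hw.2.2.2.1)
          (not_lt.2 hz')
  by_cases hM : Wm a c Bp l ∧ Wm a c Bp r
  · obtain ⟨Wl, Wr⟩ := hM
    have hlc : l ≠ c := fun e => absurd (Wm_bd hac Wr).2 (not_le.2 (e ▸ hlr))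
    have pcl := pc l Wl hlc
    have hrc : r ≠ c := by rintro rfl; omega
    have nPl := fun p => noP_of_Wm (p := p) hac Wl hlc
    have nPr := fun p => noP_of_Wm (p := p) hac Wr hrc
    have nMr : ∀ w, ¬ NextM (Wm a c Bp) p r w := fun w h =>
      absurd (h.2.2.2.1.trans_le (h.2.2.2.2 l Wl (by omega))) (not_lt.2 hlr.le)
    have e0 : r0 = r := by
      rcases hr0 with h | h | h
      · exact (nPr _ _ h).elim
      · exact (nMr _ h).elim
      · exact h.1
    subst e0
    rcases hl0 with h | h | ⟨rfl, -, h⟩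
    · exact (nPl _ _ h).elim
    · have hne : l0 ≠ r0 := by rintro rfl; have := h.2.2.1; omega
      obtain ⟨-, W0, q1, q2, q3⟩ := h
      rcases lt_or_gt_of_ne hne with hlt | hgt
      · left
        refine ⟨hlt, Or.inr (Or.inl ⟨Wl, W0, (f3 _).2 (Or.inr q1), q2, fun z hz hz' => ?_⟩),
          Or.inr (Or.inr ⟨rfl, nPr _, fun w hw => ?_⟩)⟩
        · rcases (f3 _).1 hz' with e | e
          · exact hlt.le.trans e.ge
          · exact q3 z hz e
        · exact absurd (hw.2.2.2.1.trans_le (hw.2.2.2.2 l0 W0 ((f4 _).2 q1))) (not_lt.2 hlt.le)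
      · right
        refine ⟨hgt, Or.inr (Or.inl ⟨Wl, Wr, (f3 _).2 (Or.inl rfl), hlr, fun z hz hz' => ?_⟩),
          Or.inr (Or.inl ⟨Wr, W0, (f4 _).2 q1, hgt, fun z hz hz' => q3 z hz ((f4 _).1 hz')⟩)⟩
        rcases (f3 _).1 hz' with e | e
        · exact e.ge
        · exact hgt.le.trans (q3 z hz e)
    · left
      have : ∃ z, Wm a c Bp z ∧ pos p z < pos p l0 ∧ z ≤ l0 := by
        by_contra hcon
        push Not at hcon
        obtain ⟨w, hw⟩ := nextM_exists Wl ⟨c, Or.inr (Or.inl rfl), pcl⟩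
          (fun z hz hz' => hcon z hz hz')
        exact h w hw
      obtain ⟨z, Wz, hz, hz'⟩ := this
      refine ⟨hlr, Or.inr (Or.inr ⟨rfl, nPl _, fun w hw => ?_⟩),
        Or.inr (Or.inr ⟨rfl, nPr _, fun w hw => ?_⟩)⟩
      · exact absurd (hw.2.2.2.1.trans_le (hw.2.2.2.2 z Wz ((f3 _).2 (Or.inr hz))))
          (not_lt.2 hz')
      · exact absurd (hw.2.2.2.1.trans_le (hw.2.2.2.2 z Wz ((f4 _).2 hz)))
          (not_lt.2 (hz'.trans hlr.le))
  -- the labels do not change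
  have n1 : ∀ w, NextP (Wp a c Bp) p' l w ↔ NextP (Wp a c Bp) p l w := by
    intro w
    by_cases Wl : Wp a c Bp l
    · have Wr : ¬ Wp a c Bp r := fun h => hW ⟨Wl, h⟩
      have hh : ∀ z, Wp a c Bp z → (pos p' l < pos p' z ↔ pos p l < pos p z) := by
        intro z hz
        rw [f1, f5]
        have : z ≠ r := by rintro rfl; exact Wr hz
        tauto
      unfold NextP
      constructor
      · rintro ⟨_, h2, h3, h4, h5⟩
        exact ⟨Wl, h2, (hh _ h2).1 h3, h4, fun z hz hz' => h5 z hz ((hh _ hz).2 hz')⟩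
      · rintro ⟨_, h2, h3, h4, h5⟩
        exact ⟨Wl, h2, (hh _ h2).2 h3, h4, fun z hz hz' => h5 z hz ((hh _ hz).1 hz')⟩
    · exact ⟨fun h => (Wl h.1).elim, fun h => (Wl h.1).elim⟩
  have n2 : ∀ w, NextP (Wp a c Bp) p' r w ↔ NextP (Wp a c Bp) p r w := by
    intro w
    by_cases Wr : Wp a c Bp r
    · have Wl : ¬ Wp a c Bp l := fun h => hW ⟨h, Wr⟩
      have hh : ∀ z, Wp a c Bp z → (pos p' r < pos p' z ↔ pos p r < pos p z) := by
        intro z hz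
        rw [f2]
        have : z ≠ l := by rintro rfl; exact Wl hz
        tauto
      unfold NextP
      constructor
      · rintro ⟨_, h2, h3, h4, h5⟩
        exact ⟨Wr, h2, (hh _ h2).1 h3, h4, fun z hz hz' => h5 z hz ((hh _ hz).2 hz')⟩
      · rintro ⟨_, h2, h3, h4, h5⟩
        exact ⟨Wr, h2, (hh _ h2).2 h3, h4, fun z hz hz' => h5 z hz ((hh _ hz).1 hz')⟩
    · exact ⟨fun h => (Wr h.1).elim, fun h => (Wr h.1).elim⟩
  have n3 : ∀ w, NextM (Wm a c Bp) p' l w ↔ NextM (Wm a c Bp) p l w := by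
    intro w
    by_cases Wl : Wm a c Bp l
    · have Wr : ¬ Wm a c Bp r := fun h => hM ⟨Wl, h⟩
      have hh : ∀ z, Wm a c Bp z → (pos p' z < pos p' l ↔ pos p z < pos p l) := by
        intro z hz
        rw [f3]
        have : z ≠ r := by rintro rfl; exact Wr hz
        tauto
      unfold NextM
      constructor
      · rintro ⟨_, h2, h3, h4, h5⟩
        exact ⟨Wl, h2, (hh _ h2).1 h3, h4, fun z hz hz' => h5 z hz ((hh _ hz).2 hz')⟩
      · rintro ⟨_, h2, h3, h4, h5⟩
        exact ⟨Wl, h2, (hh _ h2).2 h3, h4, fun z hz hz' => h5 z hz ((hh _ hz).1 hz')⟩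
    · exact ⟨fun h => (Wl h.1).elim, fun h => (Wl h.1).elim⟩
  have n4 : ∀ w, NextM (Wm a c Bp) p' r w ↔ NextM (Wm a c Bp) p r w := by
    intro w
    by_cases Wr : Wm a c Bp r
    · have Wl : ¬ Wm a c Bp l := fun h => hM ⟨h, Wr⟩
      have hh : ∀ z, Wm a c Bp z → (pos p' z < pos p' r ↔ pos p z < pos p r) := by
        intro z hz
        rw [f4, f6]
        have : z ≠ l := by rintro rfl; exact Wl hz
        tauto
      unfold NextM
      constructor
      · rintro ⟨_, h2, h3, h4, h5⟩
        exact ⟨Wr, h2, (hh _ h2).1 h3, h4, fun z hz hz' => h5 z hz ((hh _ hz).2 hz')⟩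
      · rintro ⟨_, h2, h3, h4, h5⟩
        exact ⟨Wr, h2, (hh _ h2).2 h3, h4, fun z hz hz' => h5 z hz ((hh _ hz).1 hz')⟩
    · exact ⟨fun h => (Wr h.1).elim, fun h => (Wr h.1).elim⟩
  left
  refine ⟨?_, by simpa only [Lab, n1, n3] using hl0, by simpa only [Lab, n2, n4] using hr0⟩
  -- impossible crossing: `l ∈ B⁻ ∪ {a}`, `r ∈ B⁺ ∪ {c}`
  have imp : Wm a c Bp l → Wp a c Bp r → False := by
    intro Ml Wr
    have hra : r ≠ a := fun e => absurd (Wm_bd hac Ml).1 (not_le.2 (e ▸ hlr))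
    have hlc : l ≠ c := fun e => absurd (Wp_bd hac Wr).2 (not_le.2 (e ▸ hlr))
    have q1 := pa r Wr hra
    have q2 := pc l Ml hlc
    rcases Ml with rfl | e | ⟨m1, m2, m3⟩
    · omega
    · exact hlc e
    rcases Wr with e | rfl | ⟨k1, k2, k3⟩
    · exact hra e
    · omega
    have := pef r l m1 hlr k2 k3 m3
    omega
  have hl : (l0 ≤ l) ∨ (Wm a c Bp l ∧ Wm a c Bp l0) := by
    rcases hl0 with h | h | h
    · exact Or.inl h.2.2.2.1.le
    · exact Or.inr ⟨h.1, h.2.1⟩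
    · exact Or.inl h.1.le
  have hr : (r ≤ r0) ∨ (Wp a c Bp r ∧ Wp a c Bp r0) := by
    rcases hr0 with h | h | h
    · exact Or.inr ⟨h.1, h.2.1⟩
    · exact Or.inl h.2.2.2.1.le
    · exact Or.inl h.1.ge
  rcases hl with hl | ⟨Ml, Ml0⟩ <;> rcases hr with hr | ⟨Wr, Wr0⟩
  · exact hl.trans_lt (hlr.trans_le hr)
  · have : l < a := by
      by_contra hcon
      rcases WpOrWm Bp (not_lt.1 hcon) (hlr.le.trans (Wp_bd hac Wr).2) with h | h
      · exact hW ⟨h, Wr⟩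
      · exact imp h Wr
    exact hl.trans_lt (this.trans_le (Wp_bd hac Wr0).1)
  · have : c < r := by
      by_contra hcon
      rcases WpOrWm Bp ((Wm_bd hac Ml).1.trans hlr.le) (not_lt.1 hcon) with h | h
      · exact imp Ml h
      · exact hM ⟨Ml, h⟩
    exact (Wm_bd hac Ml0).2.trans_lt (this.trans_le hr)
  · exact (imp Ml Wr).elim



lemma inv_step {a c : Fin n} {Bp : Fin n → Prop} {p x : Equiv.Perm (Fin n)}
    (hI : Inv a c Bp p x) {i : ℕ} (hi : 1 ≤ i ∧ i < n) (hA : Asc p i) :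
    Inv a c Bp (p * sTr n i) (dstep n x i) := by
  have hI' := hI
  obtain ⟨hac, pa, pc, pef, lab⟩ := hI
  obtain ⟨l, hl⟩ := pos_surj p (show i - 1 < n by omega)
  obtain ⟨r, hr⟩ := pos_surj p hi.2
  have hlr := hA l r (by omega) hr
  have pm := pos_mul p hi.1 hi.2
  have el : pos (p * sTr n i) l = i := by rw [pm, if_pos (by omega)]
  have er : pos (p * sTr n i) r = i - 1 := by rw [pm, if_neg (by omega), if_pos hr]
  have eo : ∀ z, z ≠ l → z ≠ r → pos (p * sTr n i) z = pos p z ∧ pos p z + 1 ≠ i ∧ pos p z ≠ i := by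
    intro z h1 h2
    have h3 : pos p z + 1 ≠ i := fun e => h1 (pos_inj p (by omega))
    have h4 : pos p z ≠ i := fun e => h2 (pos_inj p (by omega))
    rw [pm, if_neg h3, if_neg h4]
    exact ⟨rfl, h3, h4⟩
  have f1 : ∀ z, pos (p * sTr n i) l < pos (p * sTr n i) z ↔ pos p r < pos p z := by
    intro z
    by_cases h1 : z = l
    · subst h1; omega
    by_cases h2 : z = r
    · subst h2; omega
    have := eo z h1 h2; omega
  have f2 : ∀ z, pos (p * sTr n i) r < pos (p * sTr n i) z ↔ z = l ∨ pos p r < pos p z := by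
    intro z
    by_cases h1 : z = l
    · subst h1; simp; omega
    by_cases h2 : z = r
    · subst h2; simp [h1]
    have := eo z h1 h2; simp only [h1, false_or]; omega
  have f3 : ∀ z, pos (p * sTr n i) z < pos (p * sTr n i) l ↔ z = r ∨ pos p z < pos p l := by
    intro z
    by_cases h1 : z = r
    · subst h1; simp; omega
    by_cases h2 : z = l
    · subst h2; simp [h1]
    have := eo z h2 h1; simp only [h1, false_or]; omega
  have f4 : ∀ z, pos (p * sTr n i) z < pos (p * sTr n i) r ↔ pos p z < pos p l := by
    intro z
    by_cases h1 : z = l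
    · subst h1; omega
    by_cases h2 : z = r
    · subst h2; omega
    have := eo z h1 h2; omega
  obtain ⟨l0, hl0⟩ := exists_lab a c Bp p l
  obtain ⟨r0, hr0⟩ := exists_lab a c Bp p r
  have xl := lab _ _ hl0
  have xr := lab _ _ hr0
  have hst := lab_step hI' hlr (by omega) f1 f2 f3 f4 hl0 hr0
  have xm := pos_mul x hi.1 hi.2
  refine ⟨hac, fun v hv hva => ?_, fun v hv hvc => ?_, fun e f h1 h2 h3 h4 h5 => ?_, ?_⟩
  · exact pos_step hi hA (lt_of_le_of_ne (Wp_bd hac hv).1 (Ne.symm hva)) (pa v hv hva)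
  · exact pos_step hi hA (lt_of_le_of_ne (Wm_bd hac hv).2 hvc) (pc v hv hvc)
  · exact pos_step hi hA h2 (pef e f h1 h2 h3 h4 h5)
  intro v w hvw
  by_cases h1 : v = l
  · subst h1
    rw [el]
    rcases hst with ⟨h, q1, q2⟩ | ⟨h, q1, q2⟩
    · have := lab_unique hac hvw q1
      subst this
      have hx : Asc x i := fun y z hy hz => by
        have e1 : y = w := pos_inj x (by omega)
        have e2 : z = r0 := pos_inj x (by omega)
        rw [e1, e2]; exact h
      rw [dstep, if_pos ((len_lt_iff x hi.1 hi.2).2 hx), xm, if_pos (by omega)]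
    · have := lab_unique hac hvw q1
      subst this
      have hx : ¬ Asc x i := fun hx => absurd (hx l0 w (by omega) (by omega)) (not_lt.2 h.le)
      rw [dstep, if_neg (fun e => hx ((len_lt_iff x hi.1 hi.2).1 e))]
      omega
  by_cases h2 : v = r
  · subst h2
    rw [er]
    rcases hst with ⟨h, q1, q2⟩ | ⟨h, q1, q2⟩
    · have := lab_unique hac hvw q2
      subst this
      have hx : Asc x i := fun y z hy hz => by
        have e1 : y = l0 := pos_inj x (by omega)
        have e2 : z = w := pos_inj x (by omega)
        rw [e1, e2]; exact h
      rw [dstep, if_pos ((len_lt_iff x hi.1 hi.2).2 hx), xm, if_neg (by omega), if_pos (by omega)]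
    · have := lab_unique hac hvw q2
      subst this
      have hx : ¬ Asc x i := fun hx => absurd (hx w r0 (by omega) (by omega)) (not_lt.2 h.le)
      rw [dstep, if_neg (fun e => hx ((len_lt_iff x hi.1 hi.2).1 e))]
      omega
  have hv := eo v h1 h2
  have hz : ∀ z, (pos (p * sTr n i) v < pos (p * sTr n i) z ↔ pos p v < pos p z) ∧
      (pos (p * sTr n i) z < pos (p * sTr n i) v ↔ pos p z < pos p v) := by
    intro z
    by_cases z1 : z = l
    · subst z1; omega
    by_cases z2 : z = r
    · subst z2; omega
    have := eo z z1 z2; omega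
  have hvw' := (lab_other (fun z => (hz z).1) (fun z => (hz z).2) w).1 hvw
  have := lab v w hvw'
  rw [hv.1, dstep]
  split_ifs
  · rw [xm, if_neg (by omega), if_neg (by omega), this]
  · exact this

lemma inv_run {a c : Fin n} {Bp : Fin n → Prop} {p x : Equiv.Perm (Fin n)}
    (hI : Inv a c Bp p x) {B : List ℕ} (hB : AscP p B) :
    Inv a c Bp (p * wprod n B) (B.foldl (dstep n) x) := by
  induction B generalizing p x with
  | nil => simpa [wprod_nil] using hI
  | cons i B ih =>
    rw [wprod_cons, ← mul_assoc, List.foldl_cons]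
    exact ih (inv_step hI hB.1 hB.2.1) hB.2.2

lemma inv_init {u : Equiv.Perm (Fin n)} {i : ℕ} (hi : 1 ≤ i ∧ i < n) (hA : Asc u i)
    {a c : Fin n} (ha : pos u a + 1 = i) (hc : pos u c = i) :
    Inv a c (fun v => pos u v < pos u a) (u * sTr n i) u := by
  have hac := hA a c ha hc
  have pm := pos_mul u hi.1 hi.2
  have ea : pos (u * sTr n i) a = i := by rw [pm, if_pos (by omega)]
  have ec : pos (u * sTr n i) c = i - 1 := by rw [pm, if_neg (by omega), if_pos hc]
  have eo : ∀ z, z ≠ a → z ≠ c → pos (u * sTr n i) z = pos u z ∧ pos u z + 1 ≠ i ∧ pos u z ≠ i := by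
    intro z h1 h2
    have h3 : pos u z + 1 ≠ i := fun e => h1 (pos_inj u (by omega))
    have h4 : pos u z ≠ i := fun e => h2 (pos_inj u (by omega))
    rw [pm, if_neg h3, if_neg h4]
    exact ⟨rfl, h3, h4⟩
  have kp : ∀ v, Wp a c (fun v => pos u v < pos u a) v → v ≠ a → v ≠ c →
      pos (u * sTr n i) v + 1 < i := by
    intro v hv h1 h2
    have := eo v h1 h2
    rcases hv with h | h | h
    · exact (h1 h).elim
    · exact (h2 h).elim
    · have := h.2.2; omega
  have km : ∀ v, Wm a c (fun v => pos u v < pos u a) v → v ≠ a → v ≠ c →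
      i < pos (u * sTr n i) v := by
    intro v hv h1 h2
    have := eo v h1 h2
    rcases hv with h | h | h
    · exact (h1 h).elim
    · exact (h2 h).elim
    · have := h.2.2; omega
  have pa : ∀ v, Wp a c (fun v => pos u v < pos u a) v → v ≠ a →
      pos (u * sTr n i) v < pos (u * sTr n i) a := by
    intro v hv h1
    by_cases h2 : v = c
    · subst h2; omega
    · have := kp v hv h1 h2; omega
  have pc : ∀ v, Wm a c (fun v => pos u v < pos u a) v → v ≠ c →
      pos (u * sTr n i) c < pos (u * sTr n i) v := by
    intro v hv h1
    by_cases h2 : v = a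
    · subst h2; omega
    · have := km v hv h2 h1; omega
  refine ⟨hac, pa, pc, ?_, ?_⟩
  · intro e f h1 h2 h3 h4 h5
    have q1 := kp e (Or.inr (Or.inr ⟨h1.trans h2, h3, h4⟩)) (h1.trans h2).ne' h3.ne
    have q2 := km f (Or.inr (Or.inr ⟨h1, h2.trans h3, h5⟩)) h1.ne' (h2.trans h3).ne
    omega
  · intro v w hvw
    rcases hvw with ⟨Wv, Ww, q1, q2, q3⟩ | ⟨Wv, Ww, q1, q2, q3⟩ | ⟨rfl, h1, h2⟩
    · by_cases hv : v = c
      · subst hv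
        have : w = a := by
          by_contra hne
          have := kp w Ww hne q2.ne
          omega
        subst this
        omega
      · have hva : v ≠ a := by
          rintro rfl
          exact absurd q2 (not_lt.2 (Wp_bd hac Ww).1)
        have := kp v Wv hva hv
        have := q3 c (Or.inr (Or.inl rfl)) (by omega)
        exact absurd (this.trans_lt q2) (not_lt.2 (Wp_bd hac Wv).2)
    · by_cases hv : v = a
      · subst hv
        have : w = c := by
          by_contra hne
          have := km w Ww q2.ne' hne
          omega
        subst this
        omega
      · have hvc : v ≠ c := by
          rintro rfl
          exact absurd q2 (not_lt.2 (Wm_bd hac Ww).2)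
        have := km v Wv hv hvc
        have := q3 a (Or.inl rfl) (by omega)
        exact absurd (q2.trans_le this) (not_lt.2 (Wm_bd hac Wv).1)
    · by_cases hva : w = a
      · subst hva
        refine (h2 c ⟨Or.inl rfl, Or.inr (Or.inl rfl), by omega, hac, fun z hz _ => ?_⟩).elim
        by_contra hlt
        have := km z hz (by rintro rfl; omega) (not_le.1 hlt).ne
        omega
      by_cases hvc : w = c
      · subst hvc
        refine (h1 a ⟨Or.inr (Or.inl rfl), Or.inl rfl, by omega, hac, fun z hz _ => ?_⟩).elim
        by_contra hlt
        have := kp z hz (not_le.1 hlt).ne' (by rintro rfl; omega)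
        omega
      exact (eo w hva hvc).1.symm

lemma w0_lt {v w : Fin n} : pos (w0 n) v < pos (w0 n) w ↔ w < v := by
  have h1 := pos_w0 v
  have h2 := pos_w0 w
  rw [Fin.lt_def]; omega

lemma inv_out {a c : Fin n} {Bp : Fin n → Prop} {x : Equiv.Perm (Fin n)}
    (hI : Inv a c Bp (w0 n) x) {b : Fin n} (hb : b < a ∨ c < b) : pos x b = pos (w0 n) b := by
  apply hI.lab
  refine Or.inr (Or.inr ⟨rfl, fun z hz => ?_, fun z hz => ?_⟩)
  · have := Wp_bd hI.hac hz.1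
    rcases hb with h | h
    · exact absurd h (not_lt.2 this.1)
    · exact absurd h (not_lt.2 this.2)
  · have := Wm_bd hI.hac hz.1
    rcases hb with h | h
    · exact absurd h (not_lt.2 this.1)
    · exact absurd h (not_lt.2 this.2)

lemma inv_plus {a c : Fin n} {Bp : Fin n → Prop} {x : Equiv.Perm (Fin n)}
    (hI : Inv a c Bp (w0 n) x) {b : Fin n} (hb : Wp a c Bp b) (hbc : b ≠ c) :
    pos x b < pos (w0 n) b := by
  obtain ⟨v, hv, hm⟩ := Set.exists_min_image {z | Wp a c Bp z ∧ b < z} id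
    (Set.toFinite _) ⟨c, Or.inr (Or.inl rfl), lt_of_le_of_ne (Wp_bd hI.hac hb).2 hbc⟩
  rw [hI.lab v b (Or.inl ⟨hv.1, hb, w0_lt.2 hv.2, hv.2, fun z hz hz' => ?_⟩)]
  · exact w0_lt.2 hv.2
  · by_contra hlt
    exact absurd (hm z ⟨hz, not_le.1 hlt⟩) (not_le.2 (w0_lt.1 hz'))

lemma inv_minus {a c : Fin n} {Bp : Fin n → Prop} {x : Equiv.Perm (Fin n)}
    (hI : Inv a c Bp (w0 n) x) {b : Fin n} (hb : Wm a c Bp b) (hba : b ≠ a) :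
    pos (w0 n) b < pos x b := by
  obtain ⟨v, hv, hm⟩ := Set.exists_max_image {z | Wm a c Bp z ∧ z < b} id
    (Set.toFinite _) ⟨a, Or.inl rfl, lt_of_le_of_ne (Wm_bd hI.hac hb).1 (Ne.symm hba)⟩
  rw [hI.lab v b (Or.inr (Or.inl ⟨hv.1, hb, w0_lt.2 hv.2, hv.2, fun z hz hz' => ?_⟩))]
  · exact w0_lt.2 hv.2
  · by_contra hlt
    exact absurd (hm z ⟨hz, not_le.1 hlt⟩) (not_le.2 (w0_lt.1 hz'))

lemma inv_final {A B : List ℕ} {i : ℕ} (hR : AscP (1 : Equiv.Perm (Fin n)) (A ++ i :: B))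
    (hw : wprod n (A ++ i :: B) = w0 n) {a c : Fin n}
    (ha : pos (wprod n A) a + 1 = i) (hc : pos (wprod n A) c = i) :
    Inv a c (fun v => pos (wprod n A) v < pos (wprod n A) a) (w0 n) (dem n (A ++ B)) := by
  rw [ascP_append, one_mul] at hR
  have h := inv_run (inv_init hR.2.1 hR.2.2.1 ha hc) hR.2.2.2
  rw [wprod_append, wprod_cons, ← mul_assoc] at hw
  rw [hw] at h
  rw [dem_eq, List.foldl_append, foldl_dstep_asc _ hR.1, one_mul]
  exact h

end inv
end BSDist

namespace BSDist

lemma wt_snoc (n : ℕ) (R : List ℕ) (i : ℕ) (x : Equiv.Perm (Fin n)) :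
    wt n (R ++ [i]) x = if len x < len (x * sTr n i) then wt n R x + wt n R (x * sTr n i)
      else Polynomial.X * wt n R x + Polynomial.X * wt n R (x * sTr n i) := by
  unfold wt
  rw [List.foldl_append]
  rfl

lemma dem_snoc (n : ℕ) (R : List ℕ) (i : ℕ) : dem n (R ++ [i]) = dstep n (dem n R) i := by
  rw [dem_eq, dem_eq, List.foldl_append]
  rfl

/-- `x` is the Demazure product of a word obtained from `R` by deleting one letter. -/
def DelDem (n : ℕ) (R : List ℕ) (x : Equiv.Perm (Fin n)) : Prop :=
  ∃ A i B, R = A ++ i :: B ∧ dem n (A ++ B) = x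

lemma delDem_snoc (n : ℕ) (R : List ℕ) (i : ℕ) (x : Equiv.Perm (Fin n)) :
    DelDem n (R ++ [i]) x ↔ dem n R = x ∨ ∃ y, DelDem n R y ∧ dstep n y i = x := by
  constructor
  · rintro ⟨A, j, B, h, hx⟩
    rcases List.eq_nil_or_concat B with rfl | ⟨B', k, rfl⟩
    · left
      have := List.append_inj' h rfl
      rw [this.1, ← hx, List.append_nil]
    · right
      rw [List.concat_eq_append] at h hx
      have h' : R ++ [i] = (A ++ j :: B') ++ [k] := by rw [h]; simp
      have := List.append_inj' h' rfl
      have hk : i = k := by simpa using this.2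
      refine ⟨_, ⟨A, j, B', this.1, rfl⟩, ?_⟩
      rw [← dem_snoc, hk, ← hx, List.append_assoc]
  · rintro (h | ⟨y, ⟨A, j, B, h, hy⟩, hx⟩)
    · exact ⟨R, i, [], rfl, by rw [List.append_nil, h]⟩
    · refine ⟨A, j, B ++ [i], by rw [h]; simp, ?_⟩
      rw [← List.append_assoc, dem_snoc, hy, hx]

lemma dem_asc {n : ℕ} {R : List ℕ} (h : AscP (1 : Equiv.Perm (Fin n)) R) :
    dem n R = wprod n R := by
  rw [dem_eq, foldl_dstep_asc _ h, one_mul]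

lemma dstep_not_asc {n : ℕ} (y : Equiv.Perm (Fin n)) {i : ℕ} (hi : 1 ≤ i ∧ i < n) :
    ¬ Asc (dstep n y i) i := by
  unfold dstep
  split_ifs with h
  · rw [len_lt_iff y hi.1 hi.2] at h
    exact not_asc_mul y hi.1 hi.2 h
  · rw [len_lt_iff y hi.1 hi.2] at h
    exact h

lemma dstep_eq_iff {n : ℕ} {x : Equiv.Perm (Fin n)} {i : ℕ} (hi : 1 ≤ i ∧ i < n)
    (hx : ¬ Asc x i) (y : Equiv.Perm (Fin n)) :
    dstep n y i = x ↔ y = x ∨ y = x * sTr n i := by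
  unfold dstep
  split_ifs with h <;> rw [len_lt_iff y hi.1 hi.2] at h
  · constructor
    · rintro rfl; right; rw [sTr_cancel]
    · rintro (rfl | rfl)
      · exact (hx h).elim
      · rw [sTr_cancel]
  · constructor
    · exact Or.inl
    · rintro (rfl | rfl)
      · rfl
      · exact (h ((asc_mul_iff x hi.1 hi.2).2 hx)).elim

lemma coeffs {n : ℕ} (R : List ℕ) (hR : AscP (1 : Equiv.Perm (Fin n)) R) :
    ∀ x, (∀ m, R.length < m → (wt n R x).coeff m = 0) ∧
      ((wt n R x).coeff R.length = if x = wprod n R then 1 else 0) ∧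
      (∀ m, m + 1 = R.length → 0 ≤ (wt n R x).coeff m ∧
        ((wt n R x).coeff m ≠ 0 ↔ DelDem n R x)) := by
  induction R using List.reverseRecOn with
  | nil =>
    intro x
    refine ⟨fun m hm => ?_, ?_, fun m hm => ?_⟩
    · simp only [wt, List.foldl_nil]
      simp only [List.length_nil] at hm
      split_ifs
      · rw [Polynomial.coeff_one, if_neg (by omega)]
      · simp
    · simp only [wt, List.foldl_nil, wprod_nil]
      by_cases hx : x = 1 <;> simp [hx]
    · simp at hm
  | append_singleton R i ih =>
    rw [ascP_append, one_mul] at hR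
    have ih := ih hR.1
    have hi := hR.2.1
    have hw : Asc (wprod n R) i := hR.2.2.1
    have hwp : wprod n (R ++ [i]) = wprod n R * sTr n i := by
      rw [wprod_append, wprod_cons, wprod_nil, mul_one]
    intro x
    have hlen : (R ++ [i]).length = R.length + 1 := by simp
    rw [hwp, hlen, delDem_snoc, dem_asc hR.1]
    obtain ⟨p1, p2, p3⟩ := ih x
    obtain ⟨r1, r2, r3⟩ := ih (x * sTr n i)
    have hl := len_lt_iff x hi.1 hi.2
    rw [wt_snoc]
    by_cases hx : Asc x i
    · rw [if_pos (hl.2 hx)]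
      have hxs := not_asc_mul x hi.1 hi.2 hx
      have e1 : x * sTr n i ≠ wprod n R := fun e => hxs (e ▸ hw)
      rw [if_neg e1] at r2
      refine ⟨fun m hm => ?_, ?_, fun m hm => ?_⟩
      · rw [Polynomial.coeff_add, p1 m (by omega), r1 m (by omega), add_zero]
      · rw [Polynomial.coeff_add, p1 _ (by omega), r1 _ (by omega), if_neg, add_zero]
        rintro rfl
        exact not_asc_mul _ hi.1 hi.2 hw hx
      · have : m = R.length := by omega
        subst this
        rw [Polynomial.coeff_add, p2, r2, add_zero]
        constructor
        · split_ifs <;> simp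
        · have : ¬ ∃ y, DelDem n R y ∧ dstep n y i = x := by
            rintro ⟨y, -, rfl⟩
            exact dstep_not_asc y hi hx
          simp only [this, or_false]
          split_ifs with h
          · simp [h]
          · simp [Ne.symm h]
    · rw [if_neg (fun e => hx (hl.1 e))]
      have e1 : x ≠ wprod n R := fun e => hx (e ▸ hw)
      have e2 : x * sTr n i = wprod n R ↔ x = wprod n R * sTr n i := by
        constructor
        · intro e; rw [← e, sTr_cancel]
        · intro e; rw [e, sTr_cancel]
      rw [if_neg e1] at p2
      simp only [e2] at r2
      refine ⟨fun m hm => ?_, ?_, fun m hm => ?_⟩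
      · obtain ⟨k, rfl⟩ : ∃ k, m = k + 1 := ⟨m - 1, by omega⟩
        rw [Polynomial.coeff_add, Polynomial.coeff_X_mul, Polynomial.coeff_X_mul,
          p1 k (by omega), r1 k (by omega), add_zero]
      · rw [Polynomial.coeff_add, Polynomial.coeff_X_mul, Polynomial.coeff_X_mul, p2, r2, zero_add]
      · have hD : (wprod n R = x ∨ ∃ y, DelDem n R y ∧ dstep n y i = x) ↔
            DelDem n R x ∨ DelDem n R (x * sTr n i) := by
          simp only [dstep_eq_iff hi hx, Ne.symm e1, false_or]
          constructor
          · rintro ⟨y, hy, rfl | rfl⟩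
            · exact Or.inl hy
            · exact Or.inr hy
          · rintro (h | h)
            · exact ⟨_, h, Or.inl rfl⟩
            · exact ⟨_, h, Or.inr rfl⟩
        rw [hD]
        have hm : m = R.length := by omega
        subst hm
        cases hRl : R.length with
        | zero =>
          have hnil : R = [] := List.length_eq_zero_iff.1 hRl
          have hno : ∀ y, ¬ DelDem n R y := by
            rintro y ⟨A, j, B, h, -⟩
            rw [hnil] at h
            simp at h
          simp [hno]
        | succ k =>
          rw [Polynomial.coeff_add, Polynomial.coeff_X_mul, Polynomial.coeff_X_mul]
          obtain ⟨s1, s2⟩ := p3 k hRl.symm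
          obtain ⟨t1, t2⟩ := r3 k hRl.symm
          refine ⟨by omega, ?_⟩
          rw [← s2, ← t2]
          omega

/-- The ternary relation read off from the subleading coefficients. -/
def TT (n : ℕ) (f : Equiv.Perm (Fin n) → Polynomial ℤ) (a b c : Fin n) : Prop :=
  ∃ x, (f x).coeff (len (w0 n) - 1) ≠ 0 ∧
    (∀ v, v < a ∨ c < v → pos x v = pos (w0 n) v) ∧
    pos x a ≠ pos (w0 n) a ∧ pos x c ≠ pos (w0 n) c ∧ pos x b < pos (w0 n) b

/-- A pair of values crosses only once. -/
lemma cross_unique {n : ℕ} {A A' B B' : List ℕ} {i i' : ℕ}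
    (h : A ++ i :: B = A' ++ i' :: B') (hR : AscP (1 : Equiv.Perm (Fin n)) (A ++ i :: B))
    {a c : Fin n} (ha : pos (wprod n A) a + 1 = i) (hc : pos (wprod n A) c = i)
    (ha' : pos (wprod n A') a + 1 = i') (hc' : pos (wprod n A') c = i') : A = A' := by
  have key : ∀ {A A' B B' : List ℕ} {i i' : ℕ} (_ : A ++ i :: B = A' ++ i' :: B')
      (_ : AscP (1 : Equiv.Perm (Fin n)) (A ++ i :: B))
      (_ : pos (wprod n A) a + 1 = i) (_ : pos (wprod n A) c = i)
      (_ : pos (wprod n A') a + 1 = i') (_ : pos (wprod n A') c = i'),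
      ∀ D, A' = A ++ D → D = [] := by
    intro A A' B B' i i' h hR ha hc ha' hc' D hD
    cases D with
    | nil => rfl
    | cons j D =>
      exfalso
      subst hD
      rw [List.append_assoc] at h
      have h := List.append_cancel_left h
      rw [List.cons_append] at h
      obtain ⟨rfl, rfl⟩ := List.cons.inj h
      rw [ascP_append, one_mul] at hR
      obtain ⟨-, hi, hA, hS⟩ := hR
      have hac := hA a c ha hc
      rw [ascP_append] at hS
      have h1 : pos (wprod n A * sTr n i) c < pos (wprod n A * sTr n i) a := by
        rw [pos_mul _ hi.1 hi.2, pos_mul _ hi.1 hi.2, if_neg (by omega), if_pos hc, if_pos ha]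
        omega
      have h2 := pos_run hS.1 hac h1
      rw [wprod_append, wprod_cons, ← mul_assoc] at ha' hc'
      omega
  rcases List.append_eq_append_iff.1 h with ⟨D, hD, -⟩ | ⟨D, hD, -⟩
  · have := key h hR ha hc ha' hc' D hD
    rw [hD, this, List.append_nil]
  · have := key h.symm (h ▸ hR) ha' hc' ha hc D hD
    rw [hD, this, List.append_nil]

lemma TT_iff {n : ℕ} {A B : List ℕ} {i : ℕ}
    (hR : AscP (1 : Equiv.Perm (Fin n)) (A ++ i :: B)) (hw : wprod n (A ++ i :: B) = w0 n)
    (hlen : (A ++ i :: B).length = len (w0 n)) {a b c : Fin n}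
    (ha : pos (wprod n A) a + 1 = i) (hc : pos (wprod n A) c = i) (hab : a < b) (hbc : b < c) :
    TT n (wt n (A ++ i :: B)) a b c ↔ pos (wprod n A) b < pos (wprod n A) a := by
  have hpos : len (w0 n) - 1 + 1 = (A ++ i :: B).length := by
    rw [← hlen]; simp; omega
  have hco := fun x => ((coeffs _ hR x).2.2 _ hpos).2
  have hI := inv_final hR hw ha hc
  constructor
  · rintro ⟨x, h1, h2, h3, h4, h5⟩
    obtain ⟨A', i', B', hs, hx⟩ := (hco x).1 h1
    have hR' := hR
    have hw' := hw
    rw [hs] at hR' hw'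
    have hR2 := hR'
    rw [ascP_append, one_mul] at hR2
    have hi' := hR2.2.1
    obtain ⟨a', ha'⟩ := pos_surj (wprod n A') (show i' - 1 < n by omega)
    obtain ⟨c', hc'⟩ := pos_surj (wprod n A') hi'.2
    have ha'' : pos (wprod n A') a' + 1 = i' := by omega
    have hI' := inv_final hR' hw' ha'' hc'
    rw [hx] at hI'
    have xa := inv_plus hI' (Or.inl rfl) hI'.hac.ne
    have xc := inv_minus hI' (Or.inr (Or.inl rfl)) hI'.hac.ne'
    have b1 : a ≤ a' := by
      by_contra hh
      have := h2 a' (Or.inl (not_le.1 hh)); omega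
    have b2 : c' ≤ c := by
      by_contra hh
      have := h2 c' (Or.inr (not_le.1 hh)); omega
    have b3 : a' ≤ a := by
      by_contra hh
      exact h3 (inv_out hI' (Or.inl (not_le.1 hh)))
    have b4 : c ≤ c' := by
      by_contra hh
      exact h4 (inv_out hI' (Or.inr (not_le.1 hh)))
    obtain rfl := le_antisymm b1 b3
    obtain rfl := le_antisymm b4 b2
    obtain rfl := cross_unique hs hR ha hc ha'' hc'
    by_contra hh
    have := inv_minus hI' (b := b) (Or.inr (Or.inr ⟨hab, hbc, hh⟩)) hab.ne'
    omega
  · intro hb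
    refine ⟨dem n (A ++ B), (hco _).2 ⟨A, i, B, rfl, rfl⟩, fun v hv => inv_out hI hv,
      (inv_plus hI (Or.inl rfl) hI.hac.ne).ne, (inv_minus hI (Or.inr (Or.inl rfl)) hI.hac.ne').ne',
      inv_plus hI (Or.inr (Or.inr ⟨hab, hbc, hb⟩)) hbc.ne⟩

lemma good_suffix {n : ℕ} {R : List ℕ} (hR : AscP (1 : Equiv.Perm (Fin n)) R)
    (hw : wprod n R = w0 n) (hlen : R.length = len (w0 n)) (S : List ℕ) :
    ∀ A, R = A ++ S → Good (TT n (wt n R)) (wprod n A) S := by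
  induction S with
  | nil =>
    intro A hA
    rw [List.append_nil] at hA
    rw [Good, ← hA, hw]
  | cons i S ih =>
    intro A hA
    have h := ih (A ++ [i]) (by rw [hA]; simp)
    rw [wprod_append, wprod_cons, wprod_nil, mul_one] at h
    subst hA
    have hR2 := hR
    rw [ascP_append, one_mul] at hR2
    refine ⟨hR2.2.1, fun a c ha hc => ⟨hR2.2.2.1 a c ha hc, fun b hab hbc => ?_⟩, h⟩
    exact TT_iff hR hw hlen ha hc hab hbc

lemma good_word {n : ℕ} {R : List ℕ} (h : IsReducedWordFor n R (w0 n)) :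
    Good (TT n (wt n R)) 1 R :=
  good_suffix (ascP_of_reduced h.1) h.2 (by rw [h.1.2, h.2]) R [] rfl

end BSDist


namespace BSDist

/-- If `R₁, R₂` are reduced words for the longest element
`w₀ ∈ S_n` that are not commutation-equivalent, then there exists `x ∈ S_n`
with `wt_{R₁}(x) ≠ wt_{R₂}(x)`; equivalently, the Bott–Samelson distributions
`𝔓_{R₁,q}` and `𝔓_{R₂,q}` differ as rational functions of `q`. -/
theorem wt_ne_of_not_commEquiv
    (n : ℕ) (hn : 2 ≤ n) (R₁ R₂ : List ℕ)
    (h₁ : IsReducedWordFor n R₁ (w0 n)) (h₂ : IsReducedWordFor n R₂ (w0 n))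
    (h : ¬ CommEquiv R₁ R₂) :
    ∃ x : Equiv.Perm (Fin n), wt n R₁ x ≠ wt n R₂ x := by
  by_contra hcon
  push Not at hcon
  have he : wt n R₁ = wt n R₂ := funext hcon
  have g₁ := good_word h₁
  rw [he] at g₁
  exact h (good_comm g₁ (good_word h₂))

end BSDist
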